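/- arXiv:2510.14399 — 2 statements merged into one kernel-verified Lean document; each statement's English description precedes it below -/
import Mathlib

section
/- For every natural number n, ψ_0(e_n) < ψ_0(e_{n+1}). -/
open Ordinal Set

/-- The Veblen hierarchy: `phi 0` is the strictly increasing enumeration of the
additively principal ordinals (nonzero ordinals closed under addition), and for `α > 0`,
`phi α` is the strictly increasing enumeration of the common fixed points of the
functions `phi δ` for `δ < α`. -/
noncomputable def phi : Ordinal → Ordinal → Ordinal
  | α => Ordinal.enumOrd {β | (α = 0 → β ≠ 0 ∧ ∀ γ < β, ∀ δ < β, γ + δ < β) ∧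
      ∀ δ, δ < α → phi δ β = β}
termination_by α => α
decreasing_by assumption

/-- `Cr 0` is the class of additively principal ordinals (nonzero ordinals `β` such that
`γ + δ < β` for all `γ, δ < β`); for `α > 0`, `Cr α = {β | ∀ δ < α, phi δ β = β}`.
`phi α` is (definitionally) the strictly increasing enumeration of `Cr α`. -/
def Cr (α : Ordinal) : Set Ordinal :=
  {β | (α = 0 → β ≠ 0 ∧ ∀ γ < β, ∀ δ < β, γ + δ < β) ∧ ∀ δ, δ < α → phi δ β = β}

/-- An ordinal is strongly critical if it is nonzero and closed under `(δ, γ) ↦ phi δ γ`. -/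
def StronglyCritical (α : Ordinal) : Prop :=
  α ≠ 0 ∧ ∀ δ < α, ∀ γ < α, phi δ γ < α

/-- `Gamma β` is the `β`-th strongly critical ordinal. -/
noncomputable def Gamma : Ordinal → Ordinal :=
  Ordinal.enumOrd {α | StronglyCritical α}

/-- An ordinal which is (the initial ordinal of) an uncountable regular cardinal. -/
def IsUncountableRegular (o : Ordinal) : Prop :=
  ∃ κ : Cardinal, Cardinal.aleph0 < κ ∧ κ.IsRegular ∧ o = κ.ord

/-- The base sets `B_n^0(α)` (they do not depend on `α`):
`B_0^0(α) = {0} ∪ {Γ_β : β ≤ θ} ∪ {Ω_m : m ≤ ω}` and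
`B_{n+1}^0(α) = {β : β < Ω_n} ∪ {Ω_m : m ≤ ω}`. -/
def Bbase (θ : Ordinal) (Ω : ℕ → Ordinal) (Ωω : Ordinal) : ℕ → Set Ordinal
  | 0 => {0} ∪ {x | ∃ β ≤ θ, x = Gamma β} ∪ {x | (∃ m : ℕ, x = Ω m) ∨ x = Ωω}
  | n + 1 => {β | β < Ω n} ∪ {x | (∃ m : ℕ, x = Ω m) ∨ x = Ωω}

/-- One closure step, producing `B_n^{k+1}(α)` from `S = B_n^k(α)`, where the function `f`
plays the role of `ψ`:
`S ∪ {δ + δ' : δ, δ' ∈ S} ∪ {phi δ δ' : δ, δ' ∈ S} ∪ {f m δ : m < ω, δ ∈ S, δ < α}`. -/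
def Bstep (f : ℕ → Ordinal → Ordinal) (α : Ordinal) (S : Set Ordinal) : Set Ordinal :=
  S ∪ {x | ∃ δ ∈ S, ∃ δ' ∈ S, x = δ + δ'}
    ∪ {x | ∃ δ ∈ S, ∃ δ' ∈ S, x = phi δ δ'}
    ∪ {x | ∃ m : ℕ, ∃ δ ∈ S, δ < α ∧ x = f m δ}

/-- The sets `B_n^k(α)`, where the function `f` plays the role of `ψ`. -/
def Biter (θ : Ordinal) (Ω : ℕ → Ordinal) (Ωω : Ordinal)
    (f : ℕ → Ordinal → Ordinal) (α : Ordinal) (n : ℕ) : ℕ → Set Ordinal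
  | 0 => Bbase θ Ω Ωω n
  | k + 1 => Bstep f α (Biter θ Ω Ωω f α n k)

/-- `psi θ Ω Ωω n α` is the least ordinal not in `B_n(α) = ⋃ k, B_n^k(α)`.  (The values of
`ψ` are only ever used at arguments `δ < α`, so the guard `if δ < α` does not change the
sets `B_n^k(α)`; it only serves to make the recursion on `α` well-founded.) -/
noncomputable def psi (θ : Ordinal) (Ω : ℕ → Ordinal) (Ωω : Ordinal) : ℕ → Ordinal → Ordinal
  | n, α => sInf {β | β ∉ ⋃ k,
      Biter θ Ω Ωω (fun m δ => if _ : δ < α then psi θ Ω Ωω m δ else 0) α n k}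
termination_by n α => α
decreasing_by assumption

/-- The set `B_n(α) = ⋃ k, B_n^k(α)`. -/
noncomputable def Bset (θ : Ordinal) (Ω : ℕ → Ordinal) (Ωω : Ordinal)
    (n : ℕ) (α : Ordinal) : Set Ordinal :=
  ⋃ k, Biter θ Ω Ωω (fun m δ => if _ : δ < α then psi θ Ω Ωω m δ else 0) α n k

/-- The sequence `e_0 = Ω_ω + 1`, `e_{m+1} = ω ^ e_m`. -/
noncomputable def eSeq (Ωω : Ordinal) : ℕ → Ordinal
  | 0 => Ωω + 1
  | m + 1 => Ordinal.omega0 ^ eSeq Ωω m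

universe u

/-- `phi 0` is the function `α ↦ ω ^ α`. -/
theorem phi_zero_apply (α : Ordinal) : phi (0 : Ordinal) α = ω ^ α := by
  have hset : range (fun β : Ordinal => ω ^ β) =
      {β | ((0 : Ordinal) = 0 → β ≠ 0 ∧ ∀ γ < β, ∀ δ < β, γ + δ < β) ∧
        ∀ δ, δ < (0 : Ordinal) → phi δ β = β} := by
    ext β
    constructor
    · rintro ⟨γ, rfl⟩
      exact ⟨fun _ => ⟨(opow_pos γ omega0_pos).ne',
        fun a ha b hb => (isPrincipal_add_omega0_opow γ) ha hb⟩,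
        fun δ hδ => absurd hδ not_lt_zero⟩
    · rintro ⟨h, -⟩
      obtain ⟨h0, hadd⟩ := h rfl
      have hp : IsPrincipal (· + ·) β := fun a b ha hb => hadd a ha b hb
      exact (isPrincipal_add_iff_zero_or_omega0_opow.1 hp).resolve_left h0
  rw [phi, ← hset, enumOrd_range (isNormal_opow one_lt_omega0).strictMono]

section Bset

variable {θ : Ordinal} {Ω : ℕ → Ordinal} {Ωω : Ordinal} {n : ℕ}

theorem psi_eq_sInf_compl_Bset (α : Ordinal) :
    psi θ Ω Ωω n α = sInf {β | β ∉ Bset θ Ω Ωω n α} := by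
  rw [psi, Bset]

theorem Biter_mono_nat (f : ℕ → Ordinal → Ordinal) (α : Ordinal) :
    Monotone (Biter θ Ω Ωω f α n) :=
  monotone_nat_of_le_succ fun _ _ hx => Or.inl (Or.inl (Or.inl hx))

theorem Bbase_subset_Bset (α : Ordinal) : Bbase θ Ω Ωω n ⊆ Bset θ Ω Ωω n α :=
  fun _ hx => mem_iUnion.2 ⟨0, hx⟩

theorem add_mem_Bset {α x y : Ordinal} (hx : x ∈ Bset θ Ω Ωω n α) (hy : y ∈ Bset θ Ω Ωω n α) :
    x + y ∈ Bset θ Ω Ωω n α := by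
  obtain ⟨i, hi⟩ := mem_iUnion.1 hx
  obtain ⟨j, hj⟩ := mem_iUnion.1 hy
  exact mem_iUnion.2 ⟨max i j + 1, Or.inl (Or.inl (Or.inr
    ⟨x, Biter_mono_nat _ _ (le_max_left i j) hi, y, Biter_mono_nat _ _ (le_max_right i j) hj, rfl⟩))⟩

theorem phi_mem_Bset {α x y : Ordinal} (hx : x ∈ Bset θ Ω Ωω n α) (hy : y ∈ Bset θ Ω Ωω n α) :
    phi x y ∈ Bset θ Ω Ωω n α := by
  obtain ⟨i, hi⟩ := mem_iUnion.1 hx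
  obtain ⟨j, hj⟩ := mem_iUnion.1 hy
  exact mem_iUnion.2 ⟨max i j + 1, Or.inl (Or.inr
    ⟨x, Biter_mono_nat _ _ (le_max_left i j) hi, y, Biter_mono_nat _ _ (le_max_right i j) hj, rfl⟩)⟩

theorem psi_mem_Bset {α x : Ordinal} (m : ℕ) (hx : x ∈ Bset θ Ω Ωω n α) (hlt : x < α) :
    psi θ Ω Ωω m x ∈ Bset θ Ω Ωω n α := by
  obtain ⟨i, hi⟩ := mem_iUnion.1 hx
  exact mem_iUnion.2 ⟨i + 1, Or.inr ⟨m, x, hi, hlt, by simp [hlt]⟩⟩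

theorem Bset_mono {α β : Ordinal} (h : α ≤ β) : Bset θ Ω Ωω n α ⊆ Bset θ Ω Ωω n β := by
  refine iUnion_subset fun k => ?_
  induction k with
  | zero => exact Bbase_subset_Bset β
  | succ k ih =>
    rintro x (((hx | ⟨a, ha, b, hb, rfl⟩) | ⟨a, ha, b, hb, rfl⟩) | ⟨m, a, ha, hlt, rfl⟩)
    · exact ih hx
    · exact add_mem_Bset (ih ha) (ih hb)
    · exact phi_mem_Bset (ih ha) (ih hb)
    · simp only [dif_pos hlt]
      exact psi_mem_Bset m (ih ha) (hlt.trans_le h)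

end Bset

theorem small_Bbase (θ : Ordinal.{u}) (Ω : ℕ → Ordinal.{u}) (Ωω : Ordinal.{u}) (n : ℕ) :
    Small.{u} (Bbase θ Ω Ωω n) := by
  have hΩ : {x | (∃ m : ℕ, x = Ω m) ∨ x = Ωω} = range Ω ∪ {Ωω} := by
    ext x
    simp [eq_comm, or_comm]
  cases n with
  | zero =>
    have hΓ : {x | ∃ β ≤ θ, x = Gamma β} = Gamma '' Iic θ := by
      ext x
      simp [eq_comm]
    rw [Bbase, hΩ, hΓ]
    infer_instance
  | succ n =>
    rw [Bbase, hΩ]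
    change Small.{u} (Iio (Ω n) ∪ (range Ω ∪ {Ωω}) : Set Ordinal.{u})
    infer_instance

theorem small_Bstep (f : ℕ → Ordinal.{u} → Ordinal.{u}) (α : Ordinal.{u}) (S : Set Ordinal.{u})
    [Small.{u} S] : Small.{u} (Bstep f α S) := by
  have hsub : Bstep f α S ⊆
      S ∪ image2 (· + ·) S S ∪ image2 phi S S ∪ ⋃ m, f m '' S := by
    rintro x (((hx | ⟨a, ha, b, hb, rfl⟩) | ⟨a, ha, b, hb, rfl⟩) | ⟨m, a, ha, -, rfl⟩)
    · exact Or.inl (Or.inl (Or.inl hx))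
    · exact Or.inl (Or.inl (Or.inr ⟨a, ha, b, hb, rfl⟩))
    · exact Or.inl (Or.inr ⟨a, ha, b, hb, rfl⟩)
    · exact Or.inr (mem_iUnion.2 ⟨m, a, ha, rfl⟩)
  exact small_subset hsub

theorem small_Bset (θ : Ordinal.{u}) (Ω : ℕ → Ordinal.{u}) (Ωω : Ordinal.{u}) (n : ℕ)
    (α : Ordinal.{u}) : Small.{u} (Bset θ Ω Ωω n α) := by
  have hiter : ∀ k, Small.{u} (Biter θ Ω Ωω
      (fun m δ => if _ : δ < α then psi θ Ω Ωω m δ else 0) α n k) := by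
    intro k
    induction k with
    | zero => exact small_Bbase θ Ω Ωω n
    | succ k ih => exact small_Bstep _ α _
  exact small_iUnion _

theorem psi_notMem_Bset (θ : Ordinal) (Ω : ℕ → Ordinal) (Ωω : Ordinal) (n : ℕ) (α : Ordinal) :
    psi θ Ω Ωω n α ∉ Bset θ Ω Ωω n α := by
  rw [psi_eq_sInf_compl_Bset]
  refine csInf_mem (s := {β | β ∉ Bset θ Ω Ωω n α}) ?_
  have := small_Bset θ Ω Ωω n α
  obtain ⟨b, hb⟩ := bddAbove_of_small (s := Bset θ Ω Ωω n α)
  exact ⟨Order.succ b, fun h => (Order.lt_succ b).not_ge (hb h)⟩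

theorem psi_lt_psi {θ : Ordinal} {Ω : ℕ → Ordinal} {Ωω : Ordinal} {n : ℕ} {α β : Ordinal}
    (hlt : α < β) (hα : α ∈ Bset θ Ω Ωω n β) : psi θ Ω Ωω n α < psi θ Ω Ωω n β := by
  have hβ := psi_notMem_Bset θ Ω Ωω n β
  refine lt_of_le_of_ne ?_ fun h => hβ (h ▸ psi_mem_Bset n hα hlt)
  rw [psi_eq_sInf_compl_Bset α]
  exact csInf_le' fun h => hβ (Bset_mono hlt.le h)

theorem eSeq_mem_Bset (θ : Ordinal) (Ω : ℕ → Ordinal) (Ωω : Ordinal) (α : Ordinal) (m : ℕ) :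
    eSeq Ωω m ∈ Bset θ Ω Ωω 0 α := by
  have h0 : (0 : Ordinal) ∈ Bset θ Ω Ωω 0 α := Bbase_subset_Bset α (Or.inl (Or.inl rfl))
  induction m with
  | zero =>
    have h1 : (1 : Ordinal) ∈ Bset θ Ω Ωω 0 α := by
      simpa [phi_zero_apply] using phi_mem_Bset h0 h0
    exact add_mem_Bset (Bbase_subset_Bset α (Or.inr (Or.inr rfl))) h1
  | succ m ih =>
    rw [eSeq, ← phi_zero_apply]
    exact phi_mem_Bset h0 ih

theorem eSeq_lt_succ {Ωω : Ordinal} (hpos : 0 < Ωω) (m : ℕ) :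
    eSeq Ωω m < eSeq Ωω (m + 1) := by
  have hmono := (isNormal_opow one_lt_omega0).strictMono
  induction m with
  | zero =>
    have hΩω : Ωω < ω ^ (Ωω + 1) :=
      (right_le_opow Ωω one_lt_omega0).trans_lt (hmono (lt_add_one Ωω))
    have hone : 1 < (ω : Ordinal) ^ (Ωω + 1) :=
      (Order.one_le_iff_pos.2 hpos).trans_lt hΩω
    exact (isPrincipal_add_omega0_opow _) hΩω hone
  | succ m ih => exact hmono ih

/-- For every natural number `n`, `ψ_0(e_n) < ψ_0(e_{n+1})`. -/
theorem psi_eSeq_lt (θ : Ordinal) (Ω : ℕ → Ordinal) (Ωω : Ordinal)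
    (hΩreg : ∀ n : ℕ, IsUncountableRegular (Ω n)) (hΩωreg : IsUncountableRegular Ωω)
    (hΩmono : ∀ n : ℕ, Ω n < Ω (n + 1)) (hΩltω : ∀ n : ℕ, Ω n < Ωω)
    (hθ : θ < Ω 0) :
    ∀ n : ℕ, psi θ Ω Ωω 0 (eSeq Ωω n) < psi θ Ω Ωω 0 (eSeq Ωω (n + 1)) := by
  intro n
  exact psi_lt_psi (eSeq_lt_succ (bot_le.trans_lt (hΩltω 0)) n) (eSeq_mem_Bset θ Ω Ωω _ n)
end

section
/- For every nonzero ordinal α, the following are equivalent: (i) α ∈ Cr(α); (ii) α = φ_α(0); (iii) φ_β(δ) < α for all β, δ < α; (iv) φ_β(α) = α for all β < α. -/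
open Ordinal Set

theorem phi_eq_enumOrd_Cr (α : Ordinal) : phi α = enumOrd (Cr α) := by
  rw [phi, Cr]

theorem ne_zero_and_isPrincipal_add_iff_mem_range_veblen_zero {β : Ordinal} :
    (β ≠ 0 ∧ ∀ γ < β, ∀ δ < β, γ + δ < β) ↔ β ∈ range (veblen 0) := by
  have h : (∀ γ < β, ∀ δ < β, γ + δ < β) ↔ IsPrincipal (· + ·) β :=
    ⟨fun H γ δ hγ hδ ↦ H γ hγ δ hδ, fun H γ hγ δ hδ ↦ H hγ hδ⟩
  rw [h, isPrincipal_add_iff_zero_or_omega0_opow, veblen_zero]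
  constructor
  · rintro ⟨h₀, h₁⟩
    exact h₁.resolve_left h₀
  · rintro ⟨γ, rfl⟩
    exact ⟨(opow_pos γ omega0_pos).ne', Or.inr ⟨γ, rfl⟩⟩

theorem Cr_eq_range_veblen (α : Ordinal) : Cr α = range (veblen α) := by
  induction α using WellFoundedLT.induction with
  | ind α ih =>
    have hphi : ∀ δ < α, phi δ = veblen δ := fun δ hδ ↦ by
      rw [phi_eq_enumOrd_Cr, ih δ hδ, enumOrd_range (veblen_right_strictMono δ)]
    ext β
    rcases eq_or_ne α 0 with rfl | hα
    · rw [← ne_zero_and_isPrincipal_add_iff_mem_range_veblen_zero]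
      simp [Cr]
    · rw [mem_range_veblen hα]
      constructor
      · rintro ⟨-, h⟩ δ hδ
        rw [← hphi δ hδ, h δ hδ]
      · intro h
        refine ⟨fun h₀ ↦ absurd h₀ hα, fun δ hδ ↦ ?_⟩
        rw [hphi δ hδ, h δ hδ]

theorem phi_eq_veblen : phi = veblen := by
  ext1 α
  rw [phi_eq_enumOrd_Cr, Cr_eq_range_veblen, enumOrd_range (veblen_right_strictMono α)]

theorem mem_range_veblen_self_iff {α : Ordinal} : α ∈ range (veblen α) ↔ α = veblen α 0 := by
  constructor
  · rintro ⟨β, hβ⟩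
    refine (left_le_veblen α 0).antisymm ?_
    conv_rhs => rw [← hβ]
    exact (veblen_right_strictMono α).monotone zero_le
  · exact fun h ↦ ⟨0, h.symm⟩

theorem isPrincipal_veblen_iff {α : Ordinal} (hα : α ≠ 0) :
    IsPrincipal veblen α ↔ ∀ β < α, veblen β α = α := by
  constructor
  · intro h β hβ
    have hlim : Order.IsSuccLimit α := by
      rw [isSuccLimit_iff]
      refine ⟨hα, Order.isSuccPrelimit_of_succ_ne fun γ hγ ↦ ?_⟩
      subst hγ
      have hγ := Order.lt_succ γ
      have hle : veblen γ γ ≤ γ := Order.lt_succ_iff.1 (h hγ hγ)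
      rcases eq_or_ne γ 0 with rfl | h₀
      · simp at hle
      · exact hle.not_gt <| (left_le_veblen γ 0).trans_lt <|
          veblen_right_strictMono γ (pos_iff_ne_zero.2 h₀)
    refine le_antisymm ?_ (right_le_veblen β α)
    rw [(isNormal_veblen β).le_iff_forall_le hlim]
    exact fun γ hγ ↦ (h hβ hγ).le
  · intro h β δ hβ hδ
    conv_rhs => rw [← h β hβ]
    exact veblen_right_strictMono β hδ

/-- For every nonzero ordinal `α`, the following are equivalent:
(i) `α ∈ Cr α`; (ii) `α = phi α 0`; (iii) `phi β δ < α` for all `β, δ < α`;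
(iv) `phi β α = α` for all `β < α`. -/
theorem stronglyCritical_characterizations (α : Ordinal) (hα : α ≠ 0) :
    (α ∈ Cr α ↔ α = phi α 0) ∧
      (α ∈ Cr α ↔ ∀ β < α, ∀ δ < α, phi β δ < α) ∧
      (α ∈ Cr α ↔ ∀ β < α, phi β α = α) := by
  rw [Cr_eq_range_veblen, phi_eq_veblen]
  refine ⟨mem_range_veblen_self_iff, ?_, mem_range_veblen hα⟩
  rw [mem_range_veblen hα, ← isPrincipal_veblen_iff hα]
  exact ⟨fun h β hβ δ hδ ↦ h hβ hδ, fun h β δ hβ hδ ↦ h β hβ δ hδ⟩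
end
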